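/- Let n ≥ 1 and let v = (v_1, …, v_n) ∈ ℝ^n satisfy v_1 > v_2 > … > v_n and v_i − v_{i+1} > n(v_{i+1} − v_n) for all 1 ≤ i < n. Let Π be a set partition of [n], let X_Π = {x ∈ ℝ^n : x_i = x_j whenever i and j lie in the same block of Π}, and let p be the orthogonal projection of v onto X_Π. Then for any two distinct blocks B and B′ of Π with min(B) < min(B′), and any i ∈ B and j ∈ B′, one has p_i > p_j. -/

import Mathlib

open Classical

/-- A nearest point `p` to `v` has mean residual zero along every finset `B` such that moving
`p` along the indicator of `B` does not bring it closer to `v`. -/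
lemma sum_residual_eq_zero_of_dist_le {ι : Type*} [Fintype ι] (v p : EuclideanSpace ℝ ι)
    (B : Finset ι)
    (hmin : ∀ t : ℝ, dist v p ≤
      dist v (WithLp.toLp 2 fun k => p k + if k ∈ B then t else 0)) :
    ∑ k ∈ B, (v k - p k) = 0 := by
  rcases B.eq_empty_or_nonempty with rfl | hB
  · simp
  have hc : (0 : ℝ) < B.card := by exact_mod_cast hB.card_pos
  set S := ∑ k ∈ B, (v k - p k) with hS
  have key : ∀ t : ℝ, 0 ≤ -2 * t * S + B.card * t ^ 2 := by
    intro t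
    have h := hmin t
    rw [EuclideanSpace.dist_eq, EuclideanSpace.dist_eq,
      Real.sqrt_le_sqrt_iff (Finset.sum_nonneg fun _ _ => sq_nonneg _)] at h
    simp only [Real.dist_eq, sq_abs] at h
    have expand : ∑ k, (v k - (p k + if k ∈ B then t else 0)) ^ 2
        = ∑ k, (v k - p k) ^ 2 + ∑ k ∈ B, (-2 * t * (v k - p k) + t ^ 2) := by
      rw [← Finset.sum_filter_add_sum_filter_not Finset.univ (· ∈ B),
        ← Finset.sum_filter_add_sum_filter_not Finset.univ (· ∈ B) fun k => (v k - p k) ^ 2,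
        Finset.filter_univ_mem, add_right_comm, ← Finset.sum_add_distrib]
      congr 1
      · refine Finset.sum_congr rfl fun k hk => ?_
        rw [if_pos hk]
        ring
      · refine Finset.sum_congr rfl fun k hk => ?_
        rw [if_neg (Finset.mem_filter.mp hk).2, add_zero]
    rw [expand, Finset.sum_add_distrib, ← Finset.mul_sum, Finset.sum_const, nsmul_eq_mul,
      ← hS] at h
    linarith
  have h := key (S / B.card)
  have h2 : -2 * (S / B.card) * S + B.card * (S / B.card) ^ 2 = -(S ^ 2 / B.card) := by
    field_simp
    ring
  rw [h2] at h
  have h3 : S ^ 2 / B.card ≤ 0 := by linarith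
  rw [div_le_iff₀ hc, zero_mul] at h3
  exact pow_eq_zero_iff two_ne_zero |>.mp (le_antisymm h3 (sq_nonneg S))

/-- For `v` satisfying the conditions of Equation (vector), the orthogonal
projection `p` of `v` onto the flat of a set partition `P` orders the blocks by their
minima: if `min B < min B'` then the coordinates of `p` on `B` exceed those on `B'`. -/
theorem projection_orders_blocks_by_minima {n : ℕ} (hn : 1 ≤ n)
    (v : EuclideanSpace ℝ (Fin n))
    (hv1 : ∀ i j : Fin n, i < j → v j < v i)
    (hv2 : ∀ i : ℕ, ∀ h : i + 1 < n,
      (n : ℝ) * (v ⟨i + 1, h⟩ - v ⟨n - 1, by omega⟩) < v ⟨i, by omega⟩ - v ⟨i + 1, h⟩)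
    (P : Finset (Finset (Fin n)))
    (hne : ∀ B ∈ P, B.Nonempty)
    (hdisj : ∀ B ∈ P, ∀ B' ∈ P, B ≠ B' → Disjoint B B')
    (hcover : ∀ i : Fin n, ∃ B ∈ P, i ∈ B)
    (p : EuclideanSpace ℝ (Fin n))
    (hp : ∀ B ∈ P, ∀ i ∈ B, ∀ j ∈ B, p i = p j)
    (hmin : ∀ x : EuclideanSpace ℝ (Fin n),
      (∀ B ∈ P, ∀ i ∈ B, ∀ j ∈ B, x i = x j) → dist v p ≤ dist v x) :
    ∀ (B : Finset (Fin n)) (hB : B ∈ P) (B' : Finset (Fin n)) (hB' : B' ∈ P),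
      B.min' (hne B hB) < B'.min' (hne B' hB') →
      ∀ i ∈ B, ∀ j ∈ B', p j < p i := by
  intro B hB B' hB' hlt i hi j hj
  have residual : ∀ C ∈ P, ∑ k ∈ C, (v k - p k) = 0 := by
    intro C hC
    refine sum_residual_eq_zero_of_dist_le v p C fun t => hmin _ ?_
    intro D hD k hk l hl
    have hmem : k ∈ C ↔ l ∈ C := by
      by_cases hDC : D = C
      · subst hDC
        simp [hk, hl]
      · have hdis := hdisj D hD C hC hDC
        simp [Finset.disjoint_left.mp hdis hk, Finset.disjoint_left.mp hdis hl]
    simp [hp D hD k hk l hl, hmem]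
  have total : ∀ C ∈ P, ∀ l ∈ C, ∀ c : ℝ, ∑ k ∈ C, (v k - c) = C.card * (p l - c) := by
    intro C hC l hl c
    have hconst : ∑ k ∈ C, (p k - c) = C.card * (p l - c) := by
      rw [Finset.sum_congr rfl fun k hk => by rw [hp C hC k hk l hl], Finset.sum_const,
        nsmul_eq_mul]
    rw [← hconst, ← sub_eq_zero, ← Finset.sum_sub_distrib, ← residual C hC]
    exact Finset.sum_congr rfl fun k _ => by ring
  have anti : ∀ k l : Fin n, k ≤ l → v l ≤ v k := fun k l hkl =>
    hkl.eq_or_lt.elim (fun h => h ▸ le_rfl) fun h => (hv1 k l h).le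
  set a := B.min' (hne B hB)
  set b := B'.min' (hne B' hB')
  have hab : (a : ℕ) < b := hlt
  have hsucc : (a : ℕ) + 1 < n := by omega
  set m := v ⟨n - 1, by omega⟩
  have hm : ∀ k, m ≤ v k := fun k => anti _ _ (Fin.le_def.mpr (by simp only []; omega))
  have hgap : (n : ℝ) * (v ⟨a + 1, hsucc⟩ - m) < v a - v ⟨a + 1, hsucc⟩ := hv2 a hsucc
  have hlow : v a - m ≤ B.card * (p i - m) := by
    rw [← total B hB i hi m]
    exact Finset.single_le_sum (f := fun k => v k - m) (fun k _ => sub_nonneg.mpr (hm k))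
      (B.min'_mem _)
  have hup : p j ≤ v ⟨a + 1, hsucc⟩ := by
    have hsum := total B' hB' j hj (v ⟨a + 1, hsucc⟩)
    have hnonpos : ∑ k ∈ B', (v k - v ⟨a + 1, hsucc⟩) ≤ 0 := by
      refine Finset.sum_nonpos fun k hk => sub_nonpos.mpr (anti _ _ ?_)
      have hbk : (b : ℕ) ≤ k := B'.min'_le k hk
      exact Fin.le_def.mpr (by simp only []; omega)
    have hcard : (0 : ℝ) < B'.card := by exact_mod_cast Finset.card_pos.mpr ⟨j, hj⟩
    by_contra! hcon
    have := mul_pos hcard (sub_pos.mpr hcon)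
    linarith
  have hcard : (0 : ℝ) < B.card := by exact_mod_cast Finset.card_pos.mpr ⟨i, hi⟩
  have hcard_le : (B.card : ℝ) ≤ n := by
    exact_mod_cast (Finset.card_le_univ B).trans_eq (Fintype.card_fin n)
  have hnext := sub_nonneg.mpr (hm ⟨a + 1, hsucc⟩)
  have hscale := mul_le_mul_of_nonneg_right hcard_le hnext
  have hprod : B.card * (v ⟨a + 1, hsucc⟩ - m) < B.card * (p i - m) := by linarith
  have := lt_of_mul_lt_mul_left hprod hcard.le
  linarith
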